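/- arXiv:2406.08569 — 2 statements merged into one kernel-verified Lean document; each statement's English description precedes it below -/
import Mathlib

section
/- Let d ≥ 1, Δ > 0, μ > 0, and set σ = Δ/μ. For v ∈ ℝ^d let P_v denote the product measure on ℝ^d whose i-th coordinate is Gaussian with mean v_i and variance σ² (i.e. the isotropic Gaussian N(v, σ²I)). Then for all v, w ∈ ℝ^d with ‖v − w‖₂ ≤ Δ, all ε ≥ 0, and every measurable set S ⊆ ℝ^d, P_v(S) ≤ e^ε · P_w(S) + δ_μ(ε), where δ_μ(ε) = Φ(−ε/μ + μ/2) − e^ε · Φ(−ε/μ − μ/2). -/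
open MeasureTheory ProbabilityTheory

/-- The cumulative distribution function Φ of the standard normal distribution on ℝ. -/
noncomputable def stdNormalCDF (x : ℝ) : ℝ :=
  ((gaussianReal 0 1) (Set.Iic x)).toReal

/-- The Gaussian privacy curve δ_μ(ε) = Φ(−ε/μ + μ/2) − e^ε · Φ(−ε/μ − μ/2). -/
noncomputable def gdpCurve (μ ε : ℝ) : ℝ :=
  stdNormalCDF (-ε / μ + μ / 2) - Real.exp ε * stdNormalCDF (-ε / μ - μ / 2)

open scoped NNReal ENNReal

/-- A Gaussian measure has an exponential-affine density with respect to any Gaussian measure of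
the same variance. -/
lemma gaussianReal_eq_withDensity_gaussianReal (a b : ℝ) {V : ℝ≥0} (hV : V ≠ 0) :
    gaussianReal a V = (gaussianReal b V).withDensity
      (fun x ↦ ENNReal.ofReal (Real.exp (((a - b) * (x - b) - (a - b) ^ 2 / 2) / V))) := by
  rw [gaussianReal_of_var_ne_zero _ hV, gaussianReal_of_var_ne_zero _ hV,
    ← withDensity_mul _ (measurable_gaussianPDF _ _) (by fun_prop)]
  congr 1
  ext x
  have hV' : (V : ℝ) ≠ 0 := by exact_mod_cast hV
  rw [Pi.mul_apply, gaussianPDF, gaussianPDF, ← ENNReal.ofReal_mul (gaussianPDFReal_nonneg _ _ _),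
    gaussianPDFReal, gaussianPDFReal, mul_assoc _ (Real.exp _), ← Real.exp_add]
  congr 3
  field_simp
  ring

/-- The product of measures with densities has the product density. -/
lemma pi_withDensity {ι : Type*} [Fintype ι] {α : ι → Type*} [∀ i, MeasurableSpace (α i)]
    (ν : ∀ i, Measure (α i)) [∀ i, IsProbabilityMeasure (ν i)] (f : ∀ i, α i → ℝ≥0∞)
    (hf : ∀ i, Measurable (f i)) [∀ i, SigmaFinite ((ν i).withDensity (f i))] :
    Measure.pi (fun i ↦ (ν i).withDensity (f i)) =
      (Measure.pi ν).withDensity (fun x ↦ ∏ i, f i (x i)) := by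
  refine Measure.pi_eq fun s hs ↦ ?_
  rw [withDensity_apply _ (MeasurableSet.univ_pi hs),
    ← lintegral_indicator (MeasurableSet.univ_pi hs)]
  have hind : ∀ x : ∀ i, α i, (Set.univ.pi s).indicator (fun x ↦ ∏ i, f i (x i)) x =
      ∏ i, (s i).indicator (f i) (x i) := by
    intro x
    by_cases hx : x ∈ Set.univ.pi s
    · rw [Set.indicator_of_mem hx]
      exact Finset.prod_congr rfl fun i _ ↦ (Set.indicator_of_mem (hx i trivial) _).symm
    · rw [Set.indicator_of_notMem hx]
      simp only [Set.mem_univ_pi, not_forall] at hx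
      obtain ⟨i, hi⟩ := hx
      exact (Finset.prod_eq_zero (Finset.mem_univ i) (Set.indicator_of_notMem hi _)).symm
  have hm : ∀ i, Measurable ((s i).indicator (f i)) := fun i ↦ (hf i).indicator (hs i)
  simp_rw [hind]
  rw [lintegral_prod_eq_prod_lintegral_of_indepFun Finset.univ
    (fun i (x : ∀ i, α i) ↦ (s i).indicator (f i) (x i))
    (iIndepFun_pi fun i ↦ (hm i).aemeasurable) (fun i ↦ (hm i).comp (measurable_pi_apply i))]
  refine Finset.prod_congr rfl fun i _ ↦ ?_
  rw [withDensity_apply _ (hs i), ← lintegral_indicator (hs i),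
    ← (measurePreserving_eval ν i).lintegral_comp (hm i)]

/-- The density of an isotropic Gaussian measure with respect to a translate of it. -/
lemma pi_gaussianReal_eq_withDensity {ι : Type*} [Fintype ι] (v w : ι → ℝ) {V : ℝ≥0}
    (hV : V ≠ 0) :
    Measure.pi (fun i ↦ gaussianReal (v i) V) =
      (Measure.pi (fun i ↦ gaussianReal (w i) V)).withDensity (fun x ↦ ENNReal.ofReal
        (Real.exp (∑ i, ((v i - w i) * (x i - w i) - (v i - w i) ^ 2 / 2) / V))) := by
  have h : ∀ i, gaussianReal (v i) V = _ := fun i ↦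
    gaussianReal_eq_withDensity_gaussianReal (v i) (w i) hV
  have hs : ∀ i, SigmaFinite ((gaussianReal (w i) V).withDensity (fun x ↦ ENNReal.ofReal
      (Real.exp (((v i - w i) * (x - w i) - (v i - w i) ^ 2 / 2) / V)))) := by
    intro i
    rw [← h i]
    infer_instance
  simp_rw [h]
  rw [pi_withDensity _ _ (fun i ↦ by fun_prop)]
  congr 1
  ext x
  rw [Real.exp_sum, ENNReal.ofReal_prod_of_nonneg fun i _ ↦ (Real.exp_pos _).le]

/-- A linear form of a vector of independent Gaussian variables is Gaussian. -/
lemma pi_gaussianReal_map_sum_mul {ι : Type*} [Fintype ι] (c m : ι → ℝ) (V : ι → ℝ≥0) :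
    (Measure.pi (fun i ↦ gaussianReal (m i) (V i))).map (fun x ↦ ∑ i, c i * x i) =
      gaussianReal (∑ i, c i * m i) (∑ i, NNReal.mk (c i ^ 2) (sq_nonneg _) * V i) := by
  have hc : ∀ i, Measurable (fun x : ℝ ↦ c i * x) := fun i ↦ by fun_prop
  have hi : ∀ i, (Measure.pi (fun i ↦ gaussianReal (m i) (V i))).map (fun x ↦ c i * x i) =
      gaussianReal (c i * m i) (NNReal.mk (c i ^ 2) (sq_nonneg _) * V i) := by
    intro i
    rw [← gaussianReal_map_const_mul,
      ← (measurePreserving_eval (fun i ↦ gaussianReal (m i) (V i)) i).map_eq,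
      Measure.map_map (hc i) (measurable_pi_apply i)]
    rfl
  have hsum : (fun x : ι → ℝ ↦ ∑ i, c i * x i) = ∑ i, fun x : ι → ℝ ↦ c i * x i := by
    ext x
    simp
  apply Measure.ext_of_charFun
  rw [hsum, iIndepFun.charFun_map_sum_eq_prod (X := fun i (x : ι → ℝ) ↦ c i * x i)
    (fun i ↦ ((hc i).comp (measurable_pi_apply i)).aemeasurable)
    (iIndepFun_pi (X := fun i x ↦ c i * x) fun i ↦ (hc i).aemeasurable)]
  ext t
  simp_rw [Finset.prod_apply, hi, charFun_gaussianReal, ← Complex.exp_sum,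
    Finset.sum_sub_distrib]
  push_cast
  simp only [Finset.mul_sum, Finset.sum_mul, Finset.sum_div]

/-- The upper tail of a unit-variance Gaussian in terms of `stdNormalCDF`. -/
lemma gaussianReal_real_Ici (m k : ℝ) :
    (gaussianReal m 1).real (Set.Ici k) = stdNormalCDF (m - k) := by
  have h := gaussianReal_map_const_sub (μ := m) (v := 1) m
  rw [sub_self] at h
  rw [stdNormalCDF, ← h, Measure.map_apply (by fun_prop) measurableSet_Iic, measureReal_def]
  congr 2
  ext x
  simp

/-- The Neyman–Pearson inequality: if `P` dominates `c • Q` on `A` and is dominated by it off `A`,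
then `A` maximises `P - c • Q`. -/
lemma measureReal_sub_le_of_dominated {α : Type*} [MeasurableSpace α] {P Q : Measure α}
    [IsFiniteMeasure P] [IsFiniteMeasure Q] {c : ℝ} {A S : Set α}
    (hA : MeasurableSet A) (hS : MeasurableSet S)
    (hge : ∀ B ⊆ A, MeasurableSet B → c * Q.real B ≤ P.real B)
    (hle : ∀ B ⊆ Aᶜ, MeasurableSet B → P.real B ≤ c * Q.real B) :
    P.real S - c * Q.real S ≤ P.real A - c * Q.real A := by
  have h1 := hge (A \ S) Set.sdiff_subset (hA.diff hS)
  have h2 := hle (S \ A) (fun x hx ↦ hx.2) (hS.diff hA)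
  have hPS := measureReal_inter_add_sdiff (μ := P) (s := S) hA
  have hQS := measureReal_inter_add_sdiff (μ := Q) (s := S) hA
  have hPA := measureReal_inter_add_sdiff (μ := P) (s := A) hS
  have hQA := measureReal_inter_add_sdiff (μ := Q) (s := A) hS
  rw [Set.inter_comm] at hPA hQA
  rw [← hPS, ← hQS, ← hPA, ← hQA]
  linarith

/-- The privacy inequality for two isotropic Gaussian measures whose means are at distance exactly
`μ` standard deviations. -/
lemma pi_gaussianReal_real_sub_le_gdpCurve {ι : Type*} [Fintype ι] (v w : ι → ℝ) {V : ℝ≥0}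
    (hV : V ≠ 0) {μ : ℝ} (hμ : 0 < μ) (hvw : ∑ i, (v i - w i) ^ 2 = μ ^ 2 * V) (ε : ℝ)
    {S : Set (ι → ℝ)} (hS : MeasurableSet S) :
    (Measure.pi (fun i ↦ gaussianReal (v i) V)).real S -
      Real.exp ε * (Measure.pi (fun i ↦ gaussianReal (w i) V)).real S ≤ gdpCurve μ ε := by
  set P := Measure.pi (fun i ↦ gaussianReal (v i) V) with hP
  set Q := Measure.pi (fun i ↦ gaussianReal (w i) V) with hQ
  have hV' : (V : ℝ) ≠ 0 := by exact_mod_cast hV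
  set c : ι → ℝ := fun i ↦ (v i - w i) / (μ * V) with hc
  set T : (ι → ℝ) → ℝ := fun x ↦ ∑ i, c i * x i with hT
  have hTm : Measurable T := by fun_prop
  have hlog : ∀ x : ι → ℝ, ∑ i, ((v i - w i) * (x i - w i) - (v i - w i) ^ 2 / 2) / V =
      μ * (T x - T w) - μ ^ 2 / 2 := by
    intro x
    rw [← Finset.sum_div, Finset.sum_sub_distrib, ← Finset.sum_div, hvw, hT,
      ← Finset.sum_sub_distrib, Finset.mul_sum, sub_div, Finset.sum_div]
    congr 1
    · refine Finset.sum_congr rfl fun i _ ↦ ?_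
      simp only [hc]
      field_simp
    · field_simp
  have hTvw : T v = T w + μ := by
    have : T v - T w = (∑ i, (v i - w i) ^ 2) / (μ * V) := by
      rw [hT, ← Finset.sum_sub_distrib, Finset.sum_div]
      refine Finset.sum_congr rfl fun i _ ↦ ?_
      simp only [hc]
      ring
    rw [hvw] at this
    have h2 : μ ^ 2 * V / (μ * V) = μ := by field_simp
    linarith
  have hvar : ∑ i, NNReal.mk (c i ^ 2) (sq_nonneg _) * V = 1 := by
    rw [← NNReal.coe_inj]
    push_cast
    calc ∑ i, c i ^ 2 * (V : ℝ) = (∑ i, (v i - w i) ^ 2) / (μ ^ 2 * V) := by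
          rw [Finset.sum_div]
          refine Finset.sum_congr rfl fun i _ ↦ ?_
          simp only [hc]
          field_simp
      _ = 1 := by
          rw [hvw]
          field_simp
  have htail : ∀ (m : ι → ℝ) (k : ℝ),
      (Measure.pi (fun i ↦ gaussianReal (m i) V)).real (T ⁻¹' Set.Ici k) =
        stdNormalCDF (T m - k) := by
    intro m k
    rw [← map_measureReal_apply hTm measurableSet_Ici, hT, pi_gaussianReal_map_sum_mul, hvar,
      gaussianReal_real_Ici]
  have hPQ : P = _ := pi_gaussianReal_eq_withDensity v w hV
  simp_rw [hlog] at hPQ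
  have hexp : ENNReal.ofReal (Real.exp ε) ≠ ∞ := ENNReal.ofReal_ne_top
  have hreal : ∀ B, Real.exp ε * Q.real B = (ENNReal.ofReal (Real.exp ε) * Q B).toReal := by
    intro B
    rw [ENNReal.toReal_mul, ENNReal.toReal_ofReal (Real.exp_pos _).le, measureReal_def]
  have hNP := measureReal_sub_le_of_dominated (P := P) (Q := Q) (c := Real.exp ε)
    (A := T ⁻¹' Set.Ici (T w + (ε / μ + μ / 2))) (hTm measurableSet_Ici) hS ?_ ?_
  · refine hNP.trans_eq ?_
    rw [hP, hQ, htail, htail, gdpCurve, hTvw]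
    congr 2
    · ring
    · congr 1
      ring
  · intro B hB hBm
    rw [hreal, measureReal_def]
    refine ENNReal.toReal_mono (measure_ne_top _ _) ?_
    rw [hPQ, withDensity_apply _ hBm, ← setLIntegral_const]
    refine setLIntegral_mono' hBm fun x hx ↦ ENNReal.ofReal_le_ofReal (Real.exp_le_exp.2 ?_)
    have h : T w + (ε / μ + μ / 2) ≤ T x := hB hx
    have h2 : μ * (ε / μ + μ / 2) ≤ μ * (T x - T w) :=
      mul_le_mul_of_nonneg_left (by linarith) hμ.le
    have h3 : μ * (ε / μ + μ / 2) = ε + μ ^ 2 / 2 := by field_simp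
    linarith
  · intro B hB hBm
    rw [hreal, measureReal_def]
    refine ENNReal.toReal_mono (ENNReal.mul_ne_top hexp (measure_ne_top _ _)) ?_
    rw [hPQ, withDensity_apply _ hBm, ← setLIntegral_const]
    refine setLIntegral_mono' hBm fun x hx ↦ ENNReal.ofReal_le_ofReal (Real.exp_le_exp.2 ?_)
    have h : T x < T w + (ε / μ + μ / 2) := not_le.1 (hB hx)
    have h2 : μ * (T x - T w) ≤ μ * (ε / μ + μ / 2) :=
      mul_le_mul_of_nonneg_left (by linarith) hμ.le
    have h3 : μ * (ε / μ + μ / 2) = ε + μ ^ 2 / 2 := by field_simp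
    linarith

/-- Dropping the first coordinate maps a product of probability measures to the product of the
remaining factors. -/
lemma measurePreserving_pi_tail {n : ℕ} {α : Type*} [MeasurableSpace α]
    (ν : Fin (n + 1) → Measure α) [∀ i, IsProbabilityMeasure (ν i)] :
    MeasurePreserving (fun x : Fin (n + 1) → α ↦ fun i : Fin n ↦ x i.succ)
      (Measure.pi ν) (Measure.pi fun i ↦ ν i.succ) :=
  (measurePreserving_snd (μ := ν 0) (ν := Measure.pi fun i : Fin n ↦ ν i.succ)).comp
    (measurePreserving_piFinSuccAbove ν 0)

/-- The multivariate isotropic Gaussian mechanism with noise scale σ = Δ/μ is μ-GDP. -/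
theorem multivariate_gaussian_mechanism_gdp
    (d : ℕ) (hd : 1 ≤ d) (Δ μ : ℝ) (hΔ : 0 < Δ) (hμ : 0 < μ)
    (σ : ℝ) (hσ : σ = Δ / μ)
    (v w : Fin d → ℝ) (hvw : Real.sqrt (∑ i, (v i - w i) ^ 2) ≤ Δ)
    (ε : ℝ) (hε : 0 ≤ ε)
    (S : Set (Fin d → ℝ)) (hS : MeasurableSet S) :
    Measure.pi (fun i => gaussianReal (v i) ⟨σ ^ 2, sq_nonneg σ⟩) S ≤
      ENNReal.ofReal (Real.exp ε) *
        Measure.pi (fun i => gaussianReal (w i) ⟨σ ^ 2, sq_nonneg σ⟩) S +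
        ENNReal.ofReal (gdpCurve μ ε) := by
  set V : ℝ≥0 := ⟨σ ^ 2, sq_nonneg σ⟩ with hVdef
  have hσ0 : σ ≠ 0 := by
    rw [hσ]
    positivity
  have hVσ : (V : ℝ) = σ ^ 2 := rfl
  have hV : V ≠ 0 := by
    rw [← NNReal.coe_ne_zero, hVσ]
    exact pow_ne_zero 2 hσ0
  have hsq : ∑ i, (v i - w i) ^ 2 ≤ Δ ^ 2 := (Real.sqrt_le_left hΔ.le).1 hvw
  -- An extra coordinate makes the distance between the means equal to `Δ`.
  set r := Real.sqrt (Δ ^ 2 - ∑ i, (v i - w i) ^ 2) with hr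
  have hr2 : r ^ 2 = Δ ^ 2 - ∑ i, (v i - w i) ^ 2 := Real.sq_sqrt (by linarith)
  set v' : Fin (d + 1) → ℝ := Fin.cons r v with hv'
  set w' : Fin (d + 1) → ℝ := Fin.cons 0 w with hw'
  have hdist : ∑ i, (v' i - w' i) ^ 2 = μ ^ 2 * V := by
    rw [Fin.sum_univ_succ, hVσ, hσ]
    simp only [hv', hw', Fin.cons_zero, Fin.cons_succ, sub_zero, hr2]
    field_simp
    ring
  have hpv := measurePreserving_pi_tail (fun i ↦ gaussianReal (v' i) V)
  have hpw := measurePreserving_pi_tail (fun i ↦ gaussianReal (w' i) V)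
  have key := pi_gaussianReal_real_sub_le_gdpCurve v' w' hV hμ hdist ε (hpv.measurable hS)
  rw [hpv.measureReal_preimage hS.nullMeasurableSet,
    hpw.measureReal_preimage hS.nullMeasurableSet] at key
  simp only [hv', hw', Fin.cons_succ] at key
  rw [← ofReal_measureReal (μ := Measure.pi fun i ↦ gaussianReal (v i) V),
    ← ofReal_measureReal (μ := Measure.pi fun i ↦ gaussianReal (w i) V),
    ← ENNReal.ofReal_mul (Real.exp_pos ε).le]
  exact (ENNReal.ofReal_le_ofReal (by linarith)).trans ENNReal.ofReal_add_le
end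

section
/- Let n, m ≥ 1, Δ_d, Δ_s > 0, σ_d, σ_s > 0, and set μ = √(Δ_d²/σ_d² + Δ_s²/σ_s²). For a ∈ ℝ^n and b ∈ ℝ^m let P_{a,b} be the product measure on ℝ^n × ℝ^m given by N(a, σ_d² I) on the first factor and N(b, σ_s² I) on the second factor. Then for all a, a' ∈ ℝ^n with ‖a − a'‖₂ ≤ Δ_d, all b, b' ∈ ℝ^m with ‖b − b'‖₂ ≤ Δ_s, all ε ≥ 0, and every measurable S ⊆ ℝ^n × ℝ^m, P_{a,b}(S) ≤ e^ε · P_{a',b'}(S) + δ_μ(ε), where δ_μ(ε) = Φ(−ε/μ + μ/2) − e^ε · Φ(−ε/μ − μ/2). (Jointly releasing the density channel with sensitivity Δ_d and noise σ_d and the signal channel with sensitivity Δ_s and noise σ_s is μ-GDP with μ = √(Δ_s²/σ_s² + Δ_d²/σ_d²).) -/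
open MeasureTheory ProbabilityTheory

open scoped NNReal ENNReal

/-- `L` is the log-likelihood ratio of `P` with respect to `Q`, and it has the law of the privacy
loss of a Gaussian mechanism with signal-to-noise ratio `√s`. -/
structure IsGaussianLogRatio {α : Type*} [MeasurableSpace α] (P Q : Measure α) (L : α → ℝ)
    (s : ℝ≥0) : Prop where
  measurable : Measurable L
  eq_withDensity : P = Q.withDensity (fun x => ENNReal.ofReal (Real.exp (L x)))
  map_left : P.map L = gaussianReal (s / 2) s
  map_right : Q.map L = gaussianReal (-(s / 2)) s

namespace IsGaussianLogRatio

variable {α β : Type*} [MeasurableSpace α] [MeasurableSpace β]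

lemma map_add_prod {P : Measure α} {P' : Measure β} [IsProbabilityMeasure P]
    [IsProbabilityMeasure P'] {L : α → ℝ} {L' : β → ℝ} (hL : Measurable L) (hL' : Measurable L')
    {m m' : ℝ} {s s' : ℝ≥0} (h : P.map L = gaussianReal m s) (h' : P'.map L' = gaussianReal m' s') :
    (P.prod P').map (fun x => L x.1 + L' x.2) = gaussianReal (m + m') (s + s') := by
  rw [← gaussianReal_conv_gaussianReal, Measure.conv, ← h, ← h', Measure.map_prod_map _ _ hL hL',
    Measure.map_map (by fun_prop) (by fun_prop)]
  rfl

lemma prod {P Q : Measure α} {P' Q' : Measure β} [IsProbabilityMeasure P] [IsProbabilityMeasure Q]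
    [IsProbabilityMeasure P'] [IsProbabilityMeasure Q'] {L : α → ℝ} {L' : β → ℝ} {s s' : ℝ≥0}
    (h : IsGaussianLogRatio P Q L s) (h' : IsGaussianLogRatio P' Q' L' s') :
    IsGaussianLogRatio (P.prod P') (Q.prod Q') (fun x => L x.1 + L' x.2) (s + s') where
  measurable := (h.measurable.comp measurable_fst).add (h'.measurable.comp measurable_snd)
  eq_withDensity := by
    have hm := h.measurable
    have hm' := h'.measurable
    have : SFinite (Q'.withDensity fun x => ENNReal.ofReal (Real.exp (L' x))) :=
      h'.eq_withDensity ▸ inferInstance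
    rw [h.eq_withDensity, h'.eq_withDensity, prod_withDensity (by fun_prop) (by fun_prop)]
    congr with x
    rw [Real.exp_add, ENNReal.ofReal_mul (Real.exp_nonneg _)]
  map_left := by
    rw [map_add_prod h.measurable h'.measurable h.map_left h'.map_left]
    push_cast
    ring_nf
  map_right := by
    rw [map_add_prod h.measurable h'.measurable h.map_right h'.map_right]
    push_cast
    ring_nf

lemma comp_measurePreserving {P Q : Measure α} {P' Q' : Measure β} {L : β → ℝ} {s : ℝ≥0}
    (h : IsGaussianLogRatio P' Q' L s) (e : α ≃ᵐ β) (hP : MeasurePreserving e P P')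
    (hQ : MeasurePreserving e Q Q') : IsGaussianLogRatio P Q (L ∘ e) s where
  measurable := h.measurable.comp e.measurable
  eq_withDensity := by
    have hm := h.measurable
    ext S hS
    have hS' : MeasurableSet (e.symm ⁻¹' S) := e.symm.measurable hS
    have hpre : e ⁻¹' (e.symm ⁻¹' S) = S := by ext; simp
    rw [withDensity_apply _ hS, ← hpre, hP.measure_preimage hS'.nullMeasurableSet,
      h.eq_withDensity, withDensity_apply _ hS',
      ← hQ.setLIntegral_comp_preimage hS' (by fun_prop)]
    rfl
  map_left := by
    rw [← Measure.map_map h.measurable e.measurable, hP.map_eq, h.map_left]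
  map_right := by
    rw [← Measure.map_map h.measurable e.measurable, hQ.map_eq, h.map_right]

lemma refl (P : Measure α) [IsProbabilityMeasure P] : IsGaussianLogRatio P P (fun _ => 0) 0 where
  measurable := measurable_const
  eq_withDensity := by simp
  map_left := by simp [gaussianReal_zero_var, Measure.map_const]
  map_right := by simp [gaussianReal_zero_var, Measure.map_const]

end IsGaussianLogRatio

lemma gaussianReal_map_affine (m : ℝ) (v : ℝ≥0) (c d : ℝ) :
    (gaussianReal m v).map (fun x => c * x + d) =
      gaussianReal (c * m + d) (.mk (c ^ 2) (sq_nonneg c) * v) := by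
  rw [← gaussianReal_map_add_const, ← gaussianReal_map_const_mul,
    Measure.map_map (by fun_prop) (by fun_prop)]
  rfl

lemma isGaussianLogRatio_gaussianReal (a a' : ℝ) {v s : ℝ≥0} (hv : v ≠ 0)
    (hs : (s : ℝ) = (a - a') ^ 2 / v) :
    IsGaussianLogRatio (gaussianReal a v) (gaussianReal a' v)
      (fun x => (a - a') / v * x + (-((a - a') / v * a') - (a - a') ^ 2 / v / 2)) s := by
  have hv' : (v : ℝ) ≠ 0 := by exact_mod_cast hv
  have hvar : .mk (((a - a') / v) ^ 2) (sq_nonneg _) * v = s := by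
    ext
    rw [NNReal.coe_mul, hs, NNReal.coe_mk]
    field_simp
  refine ⟨by fun_prop, ?_, ?_, ?_⟩
  · rw [gaussianReal_of_var_ne_zero _ hv, gaussianReal_of_var_ne_zero _ hv,
      ← withDensity_mul _ (measurable_gaussianPDF _ _) (by fun_prop)]
    congr with x
    rw [Pi.mul_apply, gaussianPDF, gaussianPDF, ← ENNReal.ofReal_mul (gaussianPDFReal_nonneg _ _ _)]
    congr 1
    rw [gaussianPDFReal, gaussianPDFReal, mul_assoc _ (Real.exp _), ← Real.exp_add]
    congr 2
    field_simp
    ring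
  · rw [gaussianReal_map_affine, hvar, hs]
    congr 1
    field_simp
    ring
  · rw [gaussianReal_map_affine, hvar, hs]
    congr 1
    ring

lemma exists_isGaussianLogRatio_pi {v : ℝ≥0} (hv : v ≠ 0) :
    ∀ {n : ℕ} (a a' : Fin n → ℝ), ∃ (L : (Fin n → ℝ) → ℝ) (s : ℝ≥0),
      (s : ℝ) = (∑ i, (a i - a' i) ^ 2) / v ∧
      IsGaussianLogRatio (Measure.pi fun i => gaussianReal (a i) v)
        (Measure.pi fun i => gaussianReal (a' i) v) L s
  | 0, a, a' => by
    obtain rfl := Subsingleton.elim a a'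
    exact ⟨_, 0, by simp, .refl _⟩
  | n + 1, a, a' => by
    obtain ⟨L, s, hs, h⟩ := exists_isGaussianLogRatio_pi hv (fun i => a i.succ) (fun i => a' i.succ)
    have h₀ := isGaussianLogRatio_gaussianReal (a 0) (a' 0) hv
      (s := .mk ((a 0 - a' 0) ^ 2 / v) (by positivity)) rfl
    refine ⟨_, _, ?_, (h₀.prod h).comp_measurePreserving
      (MeasurableEquiv.piFinSuccAbove (fun _ => ℝ) 0)
      (measurePreserving_piFinSuccAbove (fun i => gaussianReal (a i) v) 0)
      (measurePreserving_piFinSuccAbove (fun i => gaussianReal (a' i) v) 0)⟩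
    rw [NNReal.coe_add, hs, NNReal.coe_mk, Fin.sum_univ_succ, add_div]

/-- Neyman-Pearson: among all events, `P S - c * Q S` is largest for a superlevel set of the
likelihood ratio. -/
lemma measure_add_mul_superlevel_le {α : Type*} [MeasurableSpace α] {P Q : Measure α} {f : α → ℝ≥0∞}
    (hf : Measurable f) (hP : P = Q.withDensity f) (c : ℝ≥0∞) {S : Set α} (hS : MeasurableSet S) :
    P S + c * Q {x | c ≤ f x} ≤ P {x | c ≤ f x} + c * Q S := by
  set T := {x | c ≤ f x}
  have hT : MeasurableSet T := measurableSet_le measurable_const hf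
  have h₁ : P (S \ T) ≤ c * Q (S \ T) := by
    rw [hP, withDensity_apply _ (hS.diff hT), ← setLIntegral_const]
    exact setLIntegral_mono measurable_const fun x hx => (not_le.mp hx.2).le
  have h₂ : c * Q (T \ S) ≤ P (T \ S) := by
    rw [hP, withDensity_apply _ (hT.diff hS), ← setLIntegral_const]
    exact setLIntegral_mono hf fun x hx => hx.1
  rw [← measure_inter_add_sdiff S hT, ← measure_inter_add_sdiff T hS (μ := Q),
    ← measure_inter_add_sdiff T hS (μ := P), ← measure_inter_add_sdiff S hT (μ := Q),
    Set.inter_comm T S, mul_add, mul_add]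
  calc P (S ∩ T) + P (S \ T) + (c * Q (S ∩ T) + c * Q (T \ S))
      ≤ P (S ∩ T) + c * Q (S \ T) + (c * Q (S ∩ T) + P (T \ S)) := by gcongr
    _ = P (S ∩ T) + P (T \ S) + (c * Q (S ∩ T) + c * Q (S \ T)) := by ring

lemma gaussianReal_Ici_eq_stdNormalCDF {μ : ℝ} (hμ : 0 < μ) {s : ℝ≥0} (hs : (s : ℝ) = μ ^ 2)
    (m t : ℝ) : gaussianReal m s (Set.Ici t) = ENNReal.ofReal (stdNormalCDF ((m - t) / μ)) := by
  have h : gaussianReal m s = (gaussianReal 0 1).map (fun x => -μ * x + m) := by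
    rw [gaussianReal_map_affine]
    congr 1
    · ring
    · ext; simp [hs]
  rw [h, Measure.map_apply (by fun_prop) measurableSet_Ici, stdNormalCDF,
    ENNReal.ofReal_toReal (measure_ne_top _ _)]
  congr 1
  ext x
  simp only [Set.mem_preimage, Set.mem_Ici, Set.mem_Iic, le_div_iff₀ hμ]
  constructor <;> intro h <;> linarith

lemma IsGaussianLogRatio.measure_le {α : Type*} [MeasurableSpace α] {P Q : Measure α}
    [IsProbabilityMeasure Q] {L : α → ℝ} {s : ℝ≥0} (h : IsGaussianLogRatio P Q L s)
    {μ : ℝ} (hμ : 0 < μ) (hs : (s : ℝ) = μ ^ 2) (ε : ℝ) {S : Set α} (hS : MeasurableSet S) :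
    P S ≤ ENNReal.ofReal (Real.exp ε) * Q S + ENNReal.ofReal (gdpCurve μ ε) := by
  have hm := h.measurable
  have hT : {x | ENNReal.ofReal (Real.exp ε) ≤ ENNReal.ofReal (Real.exp (L x))} =
      L ⁻¹' Set.Ici ε := by
    ext x
    simp [ENNReal.ofReal_le_ofReal_iff (Real.exp_nonneg _)]
  have hPT : P (L ⁻¹' Set.Ici ε) = ENNReal.ofReal (stdNormalCDF (-ε / μ + μ / 2)) := by
    rw [← Measure.map_apply hm measurableSet_Ici, h.map_left,
      gaussianReal_Ici_eq_stdNormalCDF hμ hs, hs]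
    congr 2
    field_simp
    ring
  have hQT : Q (L ⁻¹' Set.Ici ε) = ENNReal.ofReal (stdNormalCDF (-ε / μ - μ / 2)) := by
    rw [← Measure.map_apply hm measurableSet_Ici, h.map_right,
      gaussianReal_Ici_eq_stdNormalCDF hμ hs, hs]
    congr 2
    field_simp
    ring
  have key := measure_add_mul_superlevel_le (by fun_prop) h.eq_withDensity
    (ENNReal.ofReal (Real.exp ε)) hS
  rw [hT, hPT, hQT] at key
  have hcdf : 0 ≤ stdNormalCDF (-ε / μ - μ / 2) := ENNReal.toReal_nonneg
  rw [gdpCurve, ENNReal.ofReal_sub _ (mul_nonneg (Real.exp_nonneg _) hcdf),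
    ENNReal.ofReal_mul (Real.exp_nonneg _)]
  refine (ENNReal.le_sub_of_add_le_right (by finiteness) key).trans ?_
  rw [add_comm]
  exact add_tsub_le_assoc

/-- Jointly releasing the density channel (sensitivity Δ_d, noise σ_d) and the signal channel
(sensitivity Δ_s, noise σ_s) is μ-GDP with μ = √(Δ_d²/σ_d² + Δ_s²/σ_s²). -/
theorem joint_channels_gdp
    (n m : ℕ) (hn : 1 ≤ n) (hm : 1 ≤ m)
    (Δd Δs σd σs : ℝ) (hΔd : 0 < Δd) (hΔs : 0 < Δs) (hσd : 0 < σd) (hσs : 0 < σs)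
    (μ : ℝ) (hμ : μ = Real.sqrt (Δd ^ 2 / σd ^ 2 + Δs ^ 2 / σs ^ 2))
    (a a' : Fin n → ℝ) (ha : Real.sqrt (∑ i, (a i - a' i) ^ 2) ≤ Δd)
    (b b' : Fin m → ℝ) (hb : Real.sqrt (∑ i, (b i - b' i) ^ 2) ≤ Δs)
    (ε : ℝ) (hε : 0 ≤ ε)
    (S : Set ((Fin n → ℝ) × (Fin m → ℝ))) (hS : MeasurableSet S) :
    (Measure.pi (fun i => gaussianReal (a i) ⟨σd ^ 2, sq_nonneg σd⟩)).prod
        (Measure.pi (fun i => gaussianReal (b i) ⟨σs ^ 2, sq_nonneg σs⟩)) S ≤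
      ENNReal.ofReal (Real.exp ε) *
        ((Measure.pi (fun i => gaussianReal (a' i) ⟨σd ^ 2, sq_nonneg σd⟩)).prod
          (Measure.pi (fun i => gaussianReal (b' i) ⟨σs ^ 2, sq_nonneg σs⟩))) S +
        ENNReal.ofReal (gdpCurve μ ε) := by
  have hvd : NNReal.mk (σd ^ 2) (sq_nonneg σd) ≠ 0 := NNReal.coe_ne_zero.mp (pow_pos hσd 2).ne'
  have hvs : NNReal.mk (σs ^ 2) (sq_nonneg σs) ≠ 0 := NNReal.coe_ne_zero.mp (pow_pos hσs 2).ne'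
  obtain ⟨Ld, sd, hsd, hd⟩ := exists_isGaussianLogRatio_pi hvd a a'
  obtain ⟨Ls, ss, hss, hs⟩ := exists_isGaussianLogRatio_pi hvs b b'
  rw [NNReal.coe_mk] at hsd hss
  have hμ_pos : 0 < μ := hμ ▸ Real.sqrt_pos.mpr (by positivity)
  have hμ_sq : μ ^ 2 = Δd ^ 2 / σd ^ 2 + Δs ^ 2 / σs ^ 2 := by
    rw [hμ, Real.sq_sqrt (by positivity)]
  have hsd_le : (sd : ℝ) ≤ Δd ^ 2 / σd ^ 2 := by
    rw [hsd]
    gcongr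
    exact (Real.sqrt_le_left hΔd.le).mp ha
  have hss_le : (ss : ℝ) ≤ Δs ^ 2 / σs ^ 2 := by
    rw [hss]
    gcongr
    exact (Real.sqrt_le_left hΔs.le).mp hb
  -- An auxiliary independent Gaussian coordinate makes up for the unused sensitivity.
  set r : ℝ≥0 := .mk (μ ^ 2 - (sd + ss)) (by linarith)
  have hr := isGaussianLogRatio_gaussianReal (Real.sqrt r) 0 one_ne_zero (s := r) (by simp)
  have key := ((hd.prod hs).prod hr).measure_le hμ_pos (by simp [r]) ε (hS.prod MeasurableSet.univ)
  simp only [Measure.prod_prod, measure_univ, mul_one] at key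
  exact key
end
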